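/- Suppose C is a binary self-dual [48,24,10] code with an automorphism of order 7 of type 7-(6,6). Then π(F_σ(C)) is a binary self-dual [12,6] code such that every nonzero codeword (w_1, w_2) with w_1 ∈ F_2^6 (cycle coordinates) and w_2 ∈ F_2^6 (fixed coordinates) satisfies 7·wt(w_1) + wt(w_2) ≥ 10; such a code has a generator matrix (I_6 | A) where, up to column permutation, A is the 6×6 matrix with rows (1,1,1,0,0,0), (1,1,0,1,0,0), (1,1,0,0,1,0), (1,1,0,0,0,1), (0,1,1,1,1,1), (1,0,1,1,1,1). -/

import Mathlib

open Finset

/-- Hamming weight of a binary vector. -/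
def wt {ι : Type*} [Fintype ι] (v : ι → ZMod 2) : ℕ :=
  (Finset.univ.filter fun i => v i ≠ 0).card

/-- Dual of a binary code under the standard dot product. -/
def dualCode {ι : Type*} [Fintype ι] (C : Submodule (ZMod 2) (ι → ZMod 2)) :
    Submodule (ZMod 2) (ι → ZMod 2) where
  carrier := {x | ∀ c ∈ C, ∑ i, x i * c i = 0}
  add_mem' := by
    intro a b ha hb c hc
    have := ha c hc; have := hb c hc
    simp only [Pi.add_apply, add_mul, Finset.sum_add_distrib]
    simp [ha c hc, hb c hc]
  zero_mem' := by intro c hc; simp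
  smul_mem' := by
    intro r a ha c hc
    simp only [Pi.smul_apply, smul_eq_mul, mul_assoc, ← Finset.mul_sum]
    simp [ha c hc]

/-- Fixed subcode F_σ(C). -/
def fixedCode {ι : Type*} (σ : Equiv.Perm ι) (C : Submodule (ZMod 2) (ι → ZMod 2)) :
    Submodule (ZMod 2) (ι → ZMod 2) where
  carrier := {v | v ∈ C ∧ v ∘ σ = v}
  add_mem' := by
    rintro a b ⟨ha, ha'⟩ ⟨hb, hb'⟩
    refine ⟨C.add_mem ha hb, ?_⟩
    funext i
    simpa using congrFun (congrArg₂ (· + ·) ha' hb') i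
  zero_mem' := ⟨C.zero_mem, rfl⟩
  smul_mem' := by
    rintro r a ⟨ha, ha'⟩
    exact ⟨C.smul_mem r ha, by funext i; simpa using congrArg (r • ·) (congrFun ha' i)⟩

/-- Subcode E_σ(C): codewords with even weight on each cycle (and zero on fixed points). -/
def evenCode {ι : Type*} (p : ℕ) (σ : Equiv.Perm ι) (C : Submodule (ZMod 2) (ι → ZMod 2)) :
    Submodule (ZMod 2) (ι → ZMod 2) where
  carrier := {v | v ∈ C ∧ ∀ i, ∑ k ∈ Finset.range p, v ((σ ^ k) i) = 0}
  add_mem' := by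
    rintro a b ⟨ha, ha'⟩ ⟨hb, hb'⟩
    refine ⟨C.add_mem ha hb, fun i => ?_⟩
    simp [Finset.sum_add_distrib, ha' i, hb' i]
  zero_mem' := ⟨C.zero_mem, by simp⟩
  smul_mem' := by
    rintro r a ⟨ha, ha'⟩
    refine ⟨C.smul_mem r ha, fun i => ?_⟩
    simp only [Pi.smul_apply, smul_eq_mul]
    rw [← Finset.mul_sum, ha' i, mul_zero]

/-- Coordinate index set for an automorphism of type p-(c,f): `c` cycles of
length `p` followed by `f` fixed points. -/
abbrev Idx (p c f : ℕ) : Type := (Fin c × Fin p) ⊕ Fin f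

/-- The standard permutation with `c` cycles of length `p` and `f` fixed points. -/
def stdPerm (p c f : ℕ) : Equiv.Perm (Idx p c f) :=
  Equiv.sumCongr (Equiv.prodCongr (Equiv.refl (Fin c)) (finRotate p)) (Equiv.refl (Fin f))

/-- The projection π recording one bit per cycle and the fixed-point bits. -/
def proj (p c f : ℕ) [NeZero p] :
    (Idx p c f → ZMod 2) →ₗ[ZMod 2] ((Fin c ⊕ Fin f) → ZMod 2) where
  toFun v := Sum.elim (fun j => v (Sum.inl (j, 0))) (fun l => v (Sum.inr l))
  map_add' := by intro a b; funext i; cases i <;> simp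
  map_smul' := by intro r a; funext i; cases i <;> simp

/-- The matrix A from the paper, for type 7-(6,6). -/
def matA : Matrix (Fin 6) (Fin 6) (ZMod 2) :=
  !![1,1,1,0,0,0; 1,1,0,1,0,0; 1,1,0,0,1,0; 1,1,0,0,0,1; 0,1,1,1,1,1; 1,0,1,1,1,1]

/-- The field with eight elements `F₂[α]/(α³ + α + 1)`; the element `a + bα + cα²` is stored as the
number with binary digits `cba`. -/
def F8 : Type := Fin 8

namespace F8

instance : DecidableEq F8 := inferInstanceAs (DecidableEq (Fin 8))
instance : Fintype F8 := inferInstanceAs (Fintype (Fin 8))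

/-- Entry `(a, b)` of an `8 × 8` table of octal digits packed into one number. -/
def lookup (T : ℕ) (a b : F8) : Fin 8 :=
  ⟨Nat.mod (Nat.shiftRight T (Nat.add (Nat.mul 24 a.val) (Nat.mul 3 b.val))) 8,
    Nat.mod_lt _ (by norm_num)⟩

/-- Addition, the bitwise exclusive or. -/
protected def add (a b : F8) : F8 :=
  (⟨Nat.xor a.val b.val, Nat.xor_lt_two_pow (n := 3) a.2 b.2⟩ : Fin 8)

/-- Multiplication, given by its table. -/
protected def mul (a b : F8) : F8 :=
  lookup 2821848294356612419217921029917578219971947684264937521152 a b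

instance : Zero F8 := ⟨(0 : Fin 8)⟩
instance : One F8 := ⟨(1 : Fin 8)⟩
instance : Add F8 := ⟨F8.add⟩
instance : Mul F8 := ⟨F8.mul⟩
instance : Neg F8 := ⟨fun a => a⟩
instance : Inv F8 := ⟨fun a => a * a * (a * a) * (a * a)⟩

instance : CommRing F8 where
  add_assoc := by decide +kernel
  zero_add := by decide +kernel
  add_zero := by decide +kernel
  add_comm := by decide +kernel
  neg_add_cancel := by decide +kernel
  mul_assoc := by decide +kernel
  one_mul := by decide +kernel
  mul_one := by decide +kernel
  mul_comm := by decide +kernel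
  left_distrib := by decide +kernel
  right_distrib := by decide +kernel
  zero_mul := by decide +kernel
  mul_zero := by decide +kernel
  nsmul := nsmulRec
  zsmul := zsmulRec

instance : Field F8 where
  exists_pair_ne := ⟨0, 1, by decide⟩
  mul_inv_cancel := by decide +kernel
  inv_zero := by decide +kernel
  nnqsmul := _
  nnqsmul_def := fun _ _ => rfl
  qsmul := _
  qsmul_def := fun _ _ => rfl

instance : CharP F8 2 := CharTwo.of_one_ne_zero_of_two_eq_zero (by decide) (by decide +kernel)

/-- The generator `α`. -/
def gen : F8 := (2 : Fin 8)

/-- The absolute trace. -/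
def trace : F8 →+ ZMod 2 where
  toFun a := if Nat.testBit a.val 0 then 1 else 0
  map_zero' := by decide
  map_add' := by decide +kernel

/-- The word `(Tr(u βᵏ))ₖ` of length seven. -/
def traceWord (β u : F8) (k : Fin 7) : ZMod 2 := trace (u * β ^ (k : ℕ))

/-- The weight of `traceWord α⁻¹ u + traceWord α v`, given by its table. -/
def cycleWt (u v : F8) : ℕ :=
  (lookup 2020650956178311941526537973273262768339077498996505332000 u v).val

theorem cycleWt_eq_wt : ∀ u v : F8,
    wt (fun k => traceWord gen⁻¹ u k + traceWord gen v k) = cycleWt u v := by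
  decide +kernel

theorem wt_one_add_traceWord : ∀ u v : F8,
    wt (fun k => 1 + (traceWord gen⁻¹ u k + traceWord gen v k)) = 7 - cycleWt u v := by
  decide +kernel

theorem cycleWt_comm : ∀ u v : F8, cycleWt u v = cycleWt v u := by decide +kernel

theorem cycleWt_mul_left : ∀ r : F8, r ≠ 0 → ∀ u v, cycleWt (u * r) v = cycleWt u (r * v) := by
  decide +kernel

theorem cycleWt_zero_left : ∀ v : F8, cycleWt 0 v = if v = 0 then 0 else 4 := by decide +kernel

theorem cycleWt_inv : ∀ u : F8, u ≠ 0 → cycleWt u u⁻¹ = 6 := by decide +kernel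

theorem exists_gen_pow : ∀ r : F8, r ≠ 0 → ∃ n : Fin 7, r = gen ^ (n : ℕ) := by decide +kernel

theorem exists_gen_inv_pow : ∀ r : F8, r ≠ 0 → ∃ n : Fin 7, r = gen⁻¹ ^ (n : ℕ) := by
  decide +kernel

/-- The value at `α` of the polynomial with coefficients `c`. -/
def evalGen (c : Fin 7 → ZMod 2) : F8 := ∑ k, if c k = 0 then 0 else gen ^ (k : ℕ)

theorem traceWord_evalGen : ∀ (c : Fin 7 → ZMod 2) (k : Fin 7),
    traceWord gen⁻¹ (evalGen c) k = c k + c (k + 3) + c (k + 5) + c (k + 6) := by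
  decide +kernel

theorem traceWord_dot : ∀ (v : F8) (c : Fin 7 → ZMod 2),
    ∑ k, traceWord gen v k * c k = trace (evalGen c * v) := by
  decide +kernel

theorem traceWord_gen_mul : ∀ (u : F8) (k : Fin 7),
    traceWord gen (gen * u) k = traceWord gen u (finRotate 7 k) := by
  decide +kernel

theorem traceWord_gen_inv_mul : ∀ (u : F8) (k : Fin 7),
    traceWord gen⁻¹ (gen⁻¹ * u) k = traceWord gen⁻¹ u (finRotate 7 k) := by
  decide +kernel

end F8

namespace F8

/-- A vector with three coordinates. -/
structure Triple where
  /-- First coordinate. -/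
  x : F8
  /-- Second coordinate. -/
  y : F8
  /-- Third coordinate. -/
  z : F8

namespace Triple

/-- The dot product. -/
def dot (a b : Triple) : F8 :=
  F8.add (F8.add (F8.mul a.x b.x) (F8.mul a.y b.y)) (F8.mul a.z b.z)

/-- The cross product. -/
def cross (a b : Triple) : Triple :=
  ⟨F8.add (F8.mul a.y b.z) (F8.mul a.z b.y), F8.add (F8.mul a.x b.z) (F8.mul a.z b.x),
    F8.add (F8.mul a.x b.y) (F8.mul a.y b.x)⟩

/-- The function `Fin 3 → F8` with the given coordinates. -/
def toFun (a : Triple) : Fin 3 → F8 := ![a.x, a.y, a.z]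

end Triple

/-- A factor `c` such that both `c * a` and `c * b` have cycle weight two against `1`
(for nonzero `a` and `b`), given by its table. -/
def commonScale (a b : F8) : F8 :=
  lookup 996502715553969673786665814907003152932616851491920319049 a b

/-- `commonScale` of the first two distinct nonzero entries of a list. -/
def scaleOf (l : List F8) : F8 :=
  match l.filter (fun a => !(Nat.beq a.val 0)) with
  | [] => 1
  | a :: l =>
    match l.filter (fun b => !(Nat.beq b.val a.val)) with
    | [] => commonScale a a
    | b :: _ => commonScale a b

/-- The word with coordinate pairs `(c * uᵢ, vᵢ)`, for a suitable scale `c`, has weight between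
`1` and `8`. -/
def lowAfterScaling (u₁ v₁ u₂ v₂ u₃ v₃ u₄ v₄ u₅ v₅ u₆ v₆ : F8) : Bool :=
  let c := scaleOf [F8.mul u₁ v₁, F8.mul u₂ v₂, F8.mul u₃ v₃, F8.mul u₄ v₄, F8.mul u₅ v₅,
    F8.mul u₆ v₆]
  let n := Nat.add
    (Nat.add (Nat.add (cycleWt (F8.mul c u₁) v₁) (cycleWt (F8.mul c u₂) v₂))
      (cycleWt (F8.mul c u₃) v₃))
    (Nat.add (Nat.add (cycleWt (F8.mul c u₄) v₄) (cycleWt (F8.mul c u₅) v₅))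
      (cycleWt (F8.mul c u₆) v₆))
  Nat.ble 1 n && Nat.ble n 8

/-- Coefficient vectors of codewords with small support, for the systematic code whose redundancy
part has rows `rᵢ` and columns `cᵢ`. -/
def candidates (r₁ r₂ r₃ c₁ c₂ c₃ : Triple) : List (Triple × Triple) :=
  [(⟨0, r₃.x, r₂.x⟩, ⟨0, c₃.x, c₂.x⟩), (⟨r₃.y, 0, r₁.y⟩, ⟨c₃.y, 0, c₁.y⟩),
   (⟨r₂.z, r₁.z, 0⟩, ⟨c₂.z, c₁.z, 0⟩), (⟨r₃.z, 0, r₁.z⟩, ⟨c₂.y, c₁.y, 0⟩),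
   (⟨r₂.y, r₁.y, 0⟩, ⟨c₃.z, 0, c₁.z⟩), (⟨0, r₃.y, r₂.y⟩, ⟨c₃.x, 0, c₁.x⟩),
   (⟨r₃.x, 0, r₁.x⟩, ⟨0, c₃.y, c₂.y⟩), (⟨0, r₃.z, r₂.z⟩, ⟨c₂.x, c₁.x, 0⟩),
   (⟨r₂.x, r₁.x, 0⟩, ⟨0, c₃.z, c₂.z⟩),
   (⟨1, 0, 0⟩, r₂.cross r₃), (⟨0, 1, 0⟩, r₁.cross r₃), (⟨0, 0, 1⟩, r₁.cross r₂),
   (c₂.cross c₃, ⟨1, 0, 0⟩), (c₁.cross c₃, ⟨0, 1, 0⟩), (c₁.cross c₂, ⟨0, 0, 1⟩),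
   (⟨0, 1, 0⟩, ⟨0, 0, 0⟩), (⟨0, 0, 1⟩, ⟨0, 0, 0⟩), (⟨0, 0, 0⟩, ⟨0, 1, 0⟩),
   (⟨0, 0, 0⟩, ⟨0, 0, 1⟩),
   (⟨0, r₃.x, r₂.x⟩, ⟨0, 0, 0⟩), (⟨0, 0, 0⟩, ⟨0, c₃.x, c₂.x⟩),
   (⟨r₃.y, 0, r₁.y⟩, ⟨0, 0, 0⟩), (⟨0, 0, 0⟩, ⟨c₃.y, 0, c₁.y⟩),
   (⟨r₂.z, r₁.z, 0⟩, ⟨0, 0, 0⟩), (⟨0, 0, 0⟩, ⟨c₂.z, c₁.z, 0⟩)]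

/-- Some candidate for the redundancy part `(t 1 1; 1 p q; 1 r s)` has low weight. -/
def searchLow (t p q r s : F8) : Bool :=
  (candidates ⟨t, 1, 1⟩ ⟨1, p, q⟩ ⟨1, r, s⟩ ⟨t, 1, 1⟩ ⟨1, p, r⟩ ⟨1, q, s⟩).any fun a =>
    lowAfterScaling a.1.x (Triple.dot ⟨t, 1, 1⟩ a.2) a.1.y (Triple.dot ⟨1, p, q⟩ a.2)
      a.1.z (Triple.dot ⟨1, r, s⟩ a.2) (Triple.dot ⟨t, 1, 1⟩ a.1) a.2.x
      (Triple.dot ⟨1, p, r⟩ a.1) a.2.y (Triple.dot ⟨1, q, s⟩ a.1) a.2.z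

theorem searchLow_eq_true : ∀ t p q r s : Fin 8, t.val ≤ 1 → p.val ≤ s.val → q.val ≤ r.val →
    searchLow t p q r s = true := by
  have h : ∀ p s : Fin 8, p.val ≤ s.val → ∀ q r : Fin 8, q.val ≤ r.val →
    (searchLow (0 : Fin 8) p q r s && searchLow (1 : Fin 8) p q r s) = true := by
    decide +kernel
  intro t p q r s ht hps hqr
  have h' := h p s hps q r hqr
  rw [Bool.and_eq_true] at h'
  obtain h0 | h1 : t = 0 ∨ t = 1 := by
    rcases t with ⟨t, h⟩
    simp only [Fin.ext_iff]
    simp at *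
    omega
  · exact h0 ▸ h'.1
  · exact h1 ▸ h'.2

/-- The weight of the codeword with coefficients `x`, `y` in the code pair with redundancy `B`. -/
def systematicWt (B : Fin 3 → Fin 3 → F8) (x y : Fin 3 → F8) : ℕ :=
  ∑ i, cycleWt (x i) (∑ j, B i j * y j) + ∑ j, cycleWt (∑ i, B i j * x i) (y j)

/-- The code pair with redundancy part `B` contains a nonzero word of weight at most eight. -/
def HasLowWord (B : Fin 3 → Fin 3 → F8) : Prop :=
  ∃ x y, 1 ≤ systematicWt B x y ∧ systematicWt B x y ≤ 8

theorem hasLowWord_of_searchLow {t p q r s : F8} (h : searchLow t p q r s = true) :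
    HasLowWord ![![t, 1, 1], ![1, p, q], ![1, r, s]] := by
  obtain ⟨a, -, ha⟩ := List.any_eq_true.mp h
  simp only [lowAfterScaling, Bool.and_eq_true, Nat.ble_eq] at ha
  generalize scaleOf _ = c at ha
  refine ⟨fun i => c * a.1.toFun i, a.2.toFun, ?_⟩
  convert ha using 2 <;>
  · simp only [systematicWt, Fin.sum_univ_three, mul_left_comm _ c, ← mul_add]
    rfl

theorem HasLowWord.of_transpose {B : Fin 3 → Fin 3 → F8} (h : HasLowWord fun i j => B j i) :
    HasLowWord B := by
  obtain ⟨x, y, h⟩ := h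
  refine ⟨y, x, ?_⟩
  have : systematicWt B y x = systematicWt (fun i j => B j i) x y := by
    simp only [systematicWt]
    rw [add_comm]
    simp only [cycleWt_comm (y _), cycleWt_comm _ (x _)]
  rwa [this]

theorem HasLowWord.of_perm {B : Fin 3 → Fin 3 → F8} (e e' : Equiv.Perm (Fin 3))
    (h : HasLowWord fun i j => B (e i) (e' j)) : HasLowWord B := by
  obtain ⟨x, y, h⟩ := h
  refine ⟨x ∘ e.symm, y ∘ e'.symm, ?_⟩
  have : systematicWt B (x ∘ e.symm) (y ∘ e'.symm) =
      systematicWt (fun i j => B (e i) (e' j)) x y := by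
    have hy (i) : ∑ j, B i j * (y ∘ e'.symm) j = ∑ j, B i (e' j) * y j := by
      rw [← Equiv.sum_comp e' (fun j => B i j * (y ∘ e'.symm) j)]
      simp
    have hx (j) : ∑ i, B i j * (x ∘ e.symm) i = ∑ i, B (e i) j * x i := by
      rw [← Equiv.sum_comp e (fun i => B i j * (x ∘ e.symm) i)]
      simp
    simp only [systematicWt, hx, hy]
    rw [← Equiv.sum_comp e (fun i => cycleWt ((x ∘ e.symm) i) _),
      ← Equiv.sum_comp e' (fun j => cycleWt _ ((y ∘ e'.symm) j))]
    simp
  rwa [this]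

theorem HasLowWord.of_scale {B : Fin 3 → Fin 3 → F8} (a b : Fin 3 → F8) (ha : ∀ i, a i ≠ 0)
    (hb : ∀ j, b j ≠ 0) (h : HasLowWord fun i j => a i * B i j * b j) : HasLowWord B := by
  obtain ⟨x, y, h⟩ := h
  refine ⟨fun i => x i * a i, fun j => b j * y j, ?_⟩
  have : systematicWt B (fun i => x i * a i) (fun j => b j * y j) =
      systematicWt (fun i j => a i * B i j * b j) x y := by
    simp only [systematicWt, cycleWt_mul_left _ (ha _), ← cycleWt_mul_left _ (hb _),
      Finset.mul_sum, Finset.sum_mul]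
    refine congrArg₂ _ (Finset.sum_congr rfl fun i _ => ?_) (Finset.sum_congr rfl fun j _ => ?_)
    · exact congrArg _ (Finset.sum_congr rfl fun j _ => by ring)
    · exact congrArg (cycleWt · _) (Finset.sum_congr rfl fun i _ => by ring)
  rwa [this]

theorem hasLowWord_normalized {t : F8} (ht : t = 0 ∨ t = 1) (p q r s : F8) :
    HasLowWord ![![t, 1, 1], ![1, p, q], ![1, r, s]] := by
  have ht' : Fin.val (n := 8) t ≤ 1 := by
    rcases ht with rfl | rfl <;> decide
  have hcore (p q r s : F8) (hps : Fin.val (n := 8) p ≤ Fin.val (n := 8) s) :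
      HasLowWord ![![t, 1, 1], ![1, p, q], ![1, r, s]] := by
    rcases le_total (Fin.val (n := 8) q) (Fin.val (n := 8) r) with h | h
    · exact hasLowWord_of_searchLow (searchLow_eq_true t p q r s ht' hps h)
    · refine HasLowWord.of_transpose ?_
      convert hasLowWord_of_searchLow (searchLow_eq_true t p r q s ht' hps h) using 1
      funext i j
      fin_cases i <;> fin_cases j <;> rfl
  rcases le_total (Fin.val (n := 8) p) (Fin.val (n := 8) s) with h | h
  · exact hcore p q r s h
  · refine HasLowWord.of_perm (Equiv.swap 1 2) (Equiv.swap 1 2) ?_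
    convert hcore s r q p h using 1
    funext i j
    fin_cases i <;> fin_cases j <;> rfl

theorem hasLowWord_of_ne_zero {B : Fin 3 → Fin 3 → F8} (hr : ∀ j, j ≠ 0 → B 0 j ≠ 0)
    (hc : ∀ i, i ≠ 0 → B i 0 ≠ 0) : HasLowWord B := by
  obtain ⟨d, hd0, hd⟩ : ∃ d : F8, d ≠ 0 ∧ (B 0 0 / d = 0 ∨ B 0 0 / d = 1) := by
    by_cases h : B 0 0 = 0
    · exact ⟨1, one_ne_zero, .inl (by simp [h])⟩
    · exact ⟨B 0 0, h, .inr (div_self h)⟩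
  have h01 := hr 1 (by decide)
  have h02 := hr 2 (by decide)
  have h10 := hc 1 (by decide)
  have h20 := hc 2 (by decide)
  refine HasLowWord.of_scale ![1, d / B 1 0, d / B 2 0] ![1 / d, 1 / B 0 1, 1 / B 0 2] ?_ ?_ ?_
  · intro i; fin_cases i <;> simp [*]
  · intro i; fin_cases i <;> simp [*]
  convert hasLowWord_normalized hd (d / B 1 0 * B 1 1 * (1 / B 0 1))
    (d / B 1 0 * B 1 2 * (1 / B 0 2)) (d / B 2 0 * B 2 1 * (1 / B 0 1))
    (d / B 2 0 * B 2 2 * (1 / B 0 2)) using 1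
  funext i j
  fin_cases i <;> fin_cases j <;> simp <;> field_simp

theorem hasLowWord_of_two_zeros {B : Fin 3 → Fin 3 → F8} {i j k : Fin 3} (hjk : j ≠ k)
    (hj : B i j = 0) (hk : B i k = 0) : HasLowWord B := by
  have key : systematicWt B (Pi.single i 1) 0 = 4 + ∑ l, if B i l = 0 then 0 else 4 := by
    simp [systematicWt, Pi.single_apply, cycleWt_comm _ 0, cycleWt_zero_left,
      Finset.sum_ite_eq', apply_ite]
  refine ⟨Pi.single i 1, 0, by rw [key]; omega, ?_⟩
  have hsum : ∑ l, (if B i l = 0 then 0 else 4) ≤ ∑ l : Fin 3, if l = j ∨ l = k then 0 else 4 := by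
    refine Finset.sum_le_sum fun l _ => ?_
    by_cases h : l = j ∨ l = k
    · rcases h with rfl | rfl <;> simp [*]
    · rw [if_neg h]; split_ifs <;> simp
  have : ∀ j k : Fin 3, j ≠ k → ∑ l : Fin 3, (if l = j ∨ l = k then 0 else 4) = 4 := by decide
  rw [this j k hjk] at hsum
  omega

theorem hasLowWord (B : Fin 3 → Fin 3 → F8) : HasLowWord B := by
  by_contra hB
  have hrow (i j k) (hjk : j ≠ k) (hj : B i j = 0) : B i k ≠ 0 := fun hk =>
    hB (hasLowWord_of_two_zeros hjk hj hk)
  have hcol (i j k) (hjk : j ≠ k) (hj : B j i = 0) : B k i ≠ 0 := fun hk =>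
    hB (HasLowWord.of_transpose (hasLowWord_of_two_zeros (B := fun i j => B j i) hjk hj hk))
  by_cases h : ∃ i j, B i j = 0
  · obtain ⟨i, j, hij⟩ := h
    refine hB (HasLowWord.of_perm (Equiv.swap 0 i) (Equiv.swap 0 j) (hasLowWord_of_ne_zero ?_ ?_))
    · intro k hk
      rw [Equiv.swap_apply_left]
      refine hrow i j _ (fun h => hk ?_) hij
      rw [← (Equiv.swap 0 j).injective.eq_iff, ← h, Equiv.swap_apply_left]
    · intro k hk
      rw [Equiv.swap_apply_left]
      refine hcol j i _ (fun h => hk ?_) hij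
      rw [← (Equiv.swap 0 i).injective.eq_iff, ← h, Equiv.swap_apply_left]
  · push Not at h
    exact hB (hasLowWord_of_ne_zero (fun j _ => h 0 j) fun i _ => h i 0)

end F8

/-- Distinct orthogonal words, the second of weight three. -/
def OrthThree (a b : Fin 6 → ZMod 2) : Prop := wt b = 3 ∧ a ≠ b ∧ ∑ j, a j * b j = 0

instance (a b : Fin 6 → ZMod 2) : Decidable (OrthThree a b) :=
  inferInstanceAs (Decidable (wt b = 3 ∧ a ≠ b ∧ ∑ j, a j * b j = 0))

/-- The words of weight three orthogonal to both `a` and `b`. -/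
def orthThree₂ (a b : Fin 6 → ZMod 2) : Finset (Fin 6 → ZMod 2) :=
  {c | OrthThree a c ∧ OrthThree b c}

theorem card_orthThree_le_one : ∀ a : Fin 6 → ZMod 2, wt a = 3 → ∀ b, OrthThree a b →
    ∀ c ∈ orthThree₂ a b, #{d ∈ orthThree₂ a b | OrthThree c d} ≤ 1 := by
  decide +kernel

theorem exists_eq_one_sub_single_of_wt_five : ∀ a : Fin 6 → ZMod 2, wt a = 5 →
    ∃ i, a = fun j => if j = i then 0 else 1 := by
  decide +kernel

theorem dot_self_eq_wt : ∀ a : Fin 6 → ZMod 2, ∑ j, a j * a j = (wt a : ZMod 2) := by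
  decide +kernel

/-- An orthonormal system of six binary words of weight at least two contains one of weight five. -/
theorem exists_wt_five_of_orthonormal (w : Fin 6 → Fin 6 → ZMod 2)
    (horth : ∀ l m, ∑ j, w l j * w m j = if l = m then 1 else 0) (hwt : ∀ l, 2 ≤ wt (w l)) :
    ∃ l, wt (w l) = 5 := by
  by_contra! hne
  have h3 (l) : wt (w l) = 3 := by
    have hodd : Odd (wt (w l)) := by
      rw [← ZMod.natCast_eq_one_iff_odd, ← dot_self_eq_wt, horth, if_pos rfl]
    have hle : wt (w l) ≤ 6 := (card_filter_le _ _).trans (by simp)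
    have := hwt l
    have := hne l
    obtain ⟨k, hk⟩ := hodd
    omega
  have hpair (l m) (h : l ≠ m) : OrthThree (w l) (w m) := by
    refine ⟨h3 m, fun heq => ?_, by rw [horth, if_neg h]⟩
    have h1 := horth l m
    rw [← heq, horth, if_pos rfl, if_neg h] at h1
    exact one_ne_zero h1
  have hmem (l m) (hl : m ≠ l := by decide) : OrthThree (w m) (w l) := hpair m l hl
  have hcard := card_orthThree_le_one (w 0) (h3 0) (w 1) (hmem 1 0) (w 2)
    (by simp [orthThree₂, hmem 2 0, hmem 2 1])
  have h34 : w 3 = w 4 := Finset.card_le_one.mp hcard _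
    (by simp [orthThree₂, hmem 3 0, hmem 3 1, hmem 3 2]) _
    (by simp [orthThree₂, hmem 4 0, hmem 4 1, hmem 4 2])
  exact (hmem 4 3).2.1 h34

/-- Every linear code has a systematic basis `R` on some information set `S`. -/
theorem exists_systematic_basis {K ι : Type*} [Field K] [Fintype ι] [DecidableEq ι]
    (M : Submodule K (ι → K)) :
    ∃ (S : Finset ι) (R : ι → ι → K), (∀ s ∈ S, R s ∈ M) ∧
      (∀ s ∈ S, ∀ t ∈ S, R s t = if t = s then 1 else 0) ∧ ∀ m ∈ M, m = ∑ s ∈ S, m s • R s := by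
  classical
  obtain ⟨T, hT⟩ := (Set.toFinite
    {T : Finset ι | ∀ m ∈ M, (∀ j ∉ T, m j = 0) → m = 0}).exists_maximal
    ⟨∅, fun m _ h => funext fun j => h j (notMem_empty j)⟩
  have hrow (s : ι) : ∃ r : ι → K, s ∉ T → r ∈ M ∧ ∀ t ∉ T, r t = if t = s then 1 else 0 := by
    by_cases hs : s ∈ T
    · exact ⟨0, fun h => absurd hs h⟩
    have hins : ¬ ∀ m ∈ M, (∀ j ∉ insert s T, m j = 0) → m = 0 := fun h =>
      hs (hT.le_of_ge (y := insert s T) h (subset_insert s T) (mem_insert_self s T))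
    push Not at hins
    obtain ⟨m, hm, hsupp, hne⟩ := hins
    have hms : m s ≠ 0 := fun h0 => hne <| hT.prop m hm fun j hj => by
      rcases eq_or_ne j s with rfl | hjs
      · exact h0
      · exact hsupp j (by simp [hjs, hj])
    refine ⟨(m s)⁻¹ • m, fun _ => ⟨M.smul_mem _ hm, fun t ht => ?_⟩⟩
    split_ifs with h
    · simp [h, hms]
    · simp [hsupp t (by simp [h, ht])]
  choose R hR using hrow
  refine ⟨Tᶜ, R, fun s hs => (hR s (mem_compl.mp hs)).1,
    fun s hs t ht => (hR s (mem_compl.mp hs)).2 t (mem_compl.mp ht), fun m hm => ?_⟩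
  refine sub_eq_zero.mp (hT.prop _ (M.sub_mem hm (M.sum_mem fun s hs =>
    M.smul_mem _ (hR s (mem_compl.mp hs)).1)) fun j hj => ?_)
  have : ∑ s ∈ Tᶜ, m s * R s j = ∑ s ∈ Tᶜ, if j = s then m s else 0 :=
    sum_congr rfl fun s hs => by rw [(hR s (mem_compl.mp hs)).2 j hj, mul_ite, mul_one, mul_zero]
  simp [Finset.sum_apply, this, hj]

/-- `M₁` contains the code with generator matrix `(I | B)` on the information set `S`, and `M₂`
contains its dual, generated by `(Bᵀ | I)`. -/
structure SystematicPair {K ι : Type*} [Field K] [Fintype ι] [DecidableEq ι]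
    (M₁ M₂ : Submodule K (ι → K)) (S : Finset ι) (B : ι → ι → K) : Prop where
  left_mem (x : ι → K) : (fun j => if j ∈ S then x j else ∑ s ∈ S, B s j * x s) ∈ M₁
  right_mem (y : ι → K) : (fun j => if j ∈ S then ∑ t ∈ Sᶜ, B j t * y t else y j) ∈ M₂

namespace SystematicPair

variable {K ι : Type*} [Field K] [Fintype ι] [DecidableEq ι] {M₁ M₂ : Submodule K (ι → K)}
  {S : Finset ι} {B : ι → ι → K}

theorem symm (h : SystematicPair M₁ M₂ S B) : SystematicPair M₂ M₁ Sᶜ fun i j => B j i where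
  left_mem x := by
    convert h.right_mem x using 2 with j
    by_cases hj : j ∈ S <;> simp [hj]
  right_mem y := by
    convert h.left_mem y using 2 with j
    by_cases hj : j ∈ S <;> simp [hj]

theorem row_mem (h : SystematicPair M₁ M₂ S B) {s : ι} (hs : s ∈ S) :
    (fun j => if j ∈ S then (if j = s then 1 else 0) else B s j) ∈ M₁ := by
  convert h.left_mem (fun j => if j = s then 1 else 0) using 3
  simp [hs]

theorem mem_right_of_orthogonal [CharP K 2] (h : SystematicPair M₁ M₂ S B) {v : ι → K}
    (hv : ∀ s ∈ S, ∑ j, (if j ∈ S then (if j = s then 1 else 0) else B s j) * v j = 0) :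
    v ∈ M₂ := by
  convert h.right_mem v using 1
  funext s
  split_ifs with hs
  · have hsum := hv s hs
    rw [← sum_add_sum_compl S, sum_congr rfl (g := fun j => if j = s then v j else 0)
      (fun j hj => by simp [hj]), sum_ite_eq' S s, if_pos hs, CharTwo.add_eq_zero] at hsum
    exact hsum.trans (sum_congr rfl fun j hj => by rw [if_neg (mem_compl.mp hj)])
  · rfl

end SystematicPair

theorem exists_systematicPair {K ι : Type*} [Field K] [CharP K 2] [Fintype ι] [DecidableEq ι]
    {M₁ M₂ : Submodule K (ι → K)} (hdual : ∀ v, (∀ u ∈ M₁, ∑ j, u j * v j = 0) → v ∈ M₂) :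
    ∃ S B, SystematicPair M₁ M₂ S B := by
  obtain ⟨S, R, hR, hone, hspan⟩ := exists_systematic_basis M₁
  have hleft (x : ι → K) : (fun j => if j ∈ S then x j else ∑ s ∈ S, R s j * x s) =
      ∑ s ∈ S, x s • R s := by
    funext j
    rw [Finset.sum_apply]
    simp only [Pi.smul_apply, smul_eq_mul]
    split_ifs with hj
    · rw [sum_congr rfl (g := fun s => if j = s then x s else 0) fun s hs => by
        rw [hone s hs j hj, mul_ite, mul_one, mul_zero]]
      rw [sum_ite_eq, if_pos hj]
    · exact sum_congr rfl fun s _ => mul_comm _ _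
  refine ⟨S, R, fun x => ?_, fun y => hdual _ fun u hu => ?_⟩
  · rw [hleft]
    exact M₁.sum_mem fun s hs => M₁.smul_mem _ (hR s hs)
  · have hu' := (hspan u hu).trans (hleft u).symm
    have h2 : ∑ j ∈ Sᶜ, u j * y j = ∑ j ∈ S, u j * ∑ t ∈ Sᶜ, R j t * y t := by
      simp only [mul_sum]
      rw [sum_comm]
      refine sum_congr rfl fun t ht => ?_
      rw [hu']
      simp only [mem_compl.mp ht, if_false, sum_mul]
      exact sum_congr rfl fun s hs => by rw [if_pos hs]; ring
    rw [← sum_add_sum_compl S, CharTwo.add_eq_zero]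
    refine (sum_congr rfl fun j hj => ?_).trans (h2.symm.trans (sum_congr rfl fun j hj => ?_))
    · rw [if_pos hj]
    · rw [if_neg (mem_compl.mp hj)]

namespace F8

/-- Some pair from `M₁ × M₂` gives a nonzero word of weight at most eight. -/
def HasLowPair (M₁ M₂ : Submodule F8 (Fin 6 → F8)) : Prop :=
  ∃ u ∈ M₁, ∃ v ∈ M₂, 1 ≤ ∑ j, cycleWt (u j) (v j) ∧ ∑ j, cycleWt (u j) (v j) ≤ 8

/-- Some pair from `M₁ × M₂` gives a word whose sum with the word that is constantly one on all
cycles but the `i`-th has weight at most seven. -/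
def HasOddPair (M₁ M₂ : Submodule F8 (Fin 6 → F8)) (i : Fin 6) : Prop :=
  ∃ u ∈ M₁, ∃ v ∈ M₂,
    ∑ j, (if j = i then cycleWt (u j) (v j) else 7 - cycleWt (u j) (v j)) ≤ 7

variable {M₁ M₂ : Submodule F8 (Fin 6 → F8)}

theorem HasLowPair.symm (h : HasLowPair M₁ M₂) : HasLowPair M₂ M₁ := by
  obtain ⟨u, hu, v, hv, h⟩ := h
  exact ⟨v, hv, u, hu, by simpa only [cycleWt_comm (v _)] using h⟩

theorem HasOddPair.symm {i : Fin 6} (h : HasOddPair M₁ M₂ i) : HasOddPair M₂ M₁ i := by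
  obtain ⟨u, hu, v, hv, h⟩ := h
  exact ⟨v, hv, u, hu, by simpa only [cycleWt_comm (v _)] using h⟩

theorem hasLowPair_of_support {v : Fin 6 → F8} (hv : v ∈ M₂) {j : Fin 6} (hj : v j ≠ 0)
    {F : Finset (Fin 6)} (hF : #F ≤ 2) (hsupp : ∀ k ∉ F, v k = 0) : HasLowPair M₁ M₂ := by
  have hsum : ∑ k, cycleWt ((0 : Fin 6 → F8) k) (v k) = ∑ k, if v k = 0 then 0 else 4 :=
    sum_congr rfl fun k _ => cycleWt_zero_left (v k)
  refine ⟨0, M₁.zero_mem, v, hv, ?_, ?_⟩ <;> rw [hsum]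
  · refine le_trans ?_ (single_le_sum (f := fun k => if v k = 0 then 0 else 4)
      (fun _ _ => Nat.zero_le _) (mem_univ j))
    simp [hj]
  · calc ∑ k, (if v k = 0 then 0 else 4) = ∑ k ∈ F, if v k = 0 then 0 else 4 :=
          (sum_subset (subset_univ F) fun k _ hk => by simp [hsupp k hk]).symm
      _ ≤ ∑ k ∈ F, 4 := sum_le_sum fun k _ => by split_ifs <;> simp
      _ ≤ 8 := by simp; omega

theorem hasLowPair_of_card_le_one {S : Finset (Fin 6)} {B : Fin 6 → Fin 6 → F8}
    (h : SystematicPair M₁ M₂ S B) (hS : #S ≤ 1) : HasLowPair M₁ M₂ := by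
  obtain ⟨t, ht⟩ : ∃ t, t ∉ S := by
    by_contra! hall
    have := card_eq_of_equiv_fin (Equiv.subtypeUnivEquiv hall)
    omega
  refine hasLowPair_of_support (h.symm.row_mem (mem_compl.mpr ht)) (j := t) (F := insert t S)
    (by simp [ht]) ((card_insert_le _ _).trans (by omega)) fun k hk => ?_
  rw [mem_insert, not_or] at hk
  simp [hk]

theorem hasLowPair_of_card_eq_three {S : Finset (Fin 6)} {B : Fin 6 → Fin 6 → F8}
    (h : SystematicPair M₁ M₂ S B) (hS : #S = 3) : HasLowPair M₁ M₂ := by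
  have hS' : #Sᶜ = 3 := by rw [card_compl, hS]; rfl
  let e := S.equivFinOfCardEq hS
  let e' := Sᶜ.equivFinOfCardEq hS'
  obtain ⟨x, y, hxy⟩ := hasLowWord fun i j => B (e.symm i) (e'.symm j)
  have sum_S {N : Type} [AddCommMonoid N] (f : Fin 6 → N) :
      ∑ j ∈ S, f j = ∑ i, f (e.symm i) := by
    rw [← sum_coe_sort S, ← Equiv.sum_comp e.symm]
  have sum_S' {N : Type} [AddCommMonoid N] (f : Fin 6 → N) :
      ∑ j ∈ Sᶜ, f j = ∑ i, f (e'.symm i) := by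
    rw [← sum_coe_sort Sᶜ, ← Equiv.sum_comp e'.symm]
  let x' : Fin 6 → F8 := fun j => if hj : j ∈ S then x (e ⟨j, hj⟩) else 0
  let y' : Fin 6 → F8 := fun j => if hj : j ∈ Sᶜ then y (e' ⟨j, hj⟩) else 0
  have hx (i) : x' (e.symm i) = x i := by simp [x']
  have hy (i) : y' (e'.symm i) = y i := by
    simp only [y']
    rw [dif_pos (e'.symm i).2]
    simp
  have he (i) : (e.symm i : Fin 6) ∈ S := (e.symm i).2
  have he' (i) : (e'.symm i : Fin 6) ∉ S := mem_compl.mp (e'.symm i).2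
  refine ⟨_, h.left_mem x', _, h.right_mem y', ?_⟩
  convert hxy using 2 <;>
  · rw [← sum_add_sum_compl S, sum_S, sum_S']
    simp only [he, he', if_true, if_false, sum_S, sum_S', hx, hy]
    rfl

theorem exists_sum_erase_eq_zero : ∀ A : Finset F8, #A = 5 → ∃ a ∈ A, ∑ b ∈ A.erase a, b = 0 := by
  decide +kernel

theorem hasLowPair_of_det_eq_zero {m n : Fin 6 → F8}
    (hM₂ : ∀ v, ∑ j, m j * v j = 0 → ∑ j, n j * v j = 0 → v ∈ M₂) {j k : Fin 6} (hjk : j ≠ k)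
    (hdet : m j * n k = m k * n j) : HasLowPair M₁ M₂ := by
  have key (a b : F8) (hm : m j * a + m k * b = 0) (hn : n j * a + n k * b = 0)
      (hab : a ≠ 0 ∨ b ≠ 0) : HasLowPair M₁ M₂ := by
    have hv : (Pi.single j a + Pi.single k b : Fin 6 → F8) ∈ M₂ := hM₂ _
      (by simpa [mul_add, sum_add_distrib, Pi.single_apply] using hm)
      (by simpa [mul_add, sum_add_distrib, Pi.single_apply] using hn)
    have hsupp : ∀ l ∉ ({j, k} : Finset (Fin 6)),
        (Pi.single j a + Pi.single k b : Fin 6 → F8) l = 0 := by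
      intro l hl
      simp only [mem_insert, mem_singleton, not_or] at hl
      simp [hl]
    rcases hab with ha | hb
    · exact hasLowPair_of_support hv (j := j) (by simpa [Pi.single_apply, hjk] using ha)
        card_le_two hsupp
    · exact hasLowPair_of_support hv (j := k) (by simpa [Pi.single_apply, hjk.symm] using hb)
        card_le_two hsupp
  by_cases hm : m j = 0 ∧ m k = 0
  · by_cases hn : n j = 0 ∧ n k = 0
    · exact key 1 0 (by simp [hm]) (by simp [hn]) (.inl one_ne_zero)
    · refine key (n k) (n j) (by simp [hm]) ?_ (by tauto)
      rw [mul_comm]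
      exact CharTwo.add_self_eq_zero _
  · refine key (m k) (m j) ?_ ?_ (by tauto)
    · rw [mul_comm]
      exact CharTwo.add_self_eq_zero _
    · rw [mul_comm, ← hdet, mul_comm]
      exact CharTwo.add_self_eq_zero _

theorem hasOddPair_of_det_ne_zero {m n : Fin 6 → F8} (hm : m ∈ M₁) (hn : n ∈ M₁)
    (hM₂ : ∀ v, ∑ j, m j * v j = 0 → ∑ j, n j * v j = 0 → v ∈ M₂)
    (hdet : ∀ j k, j ≠ k → m j * n k ≠ m k * n j) {i : Fin 6} (hi : m i ≠ 0) :
    HasOddPair M₁ M₂ i := by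
  set w : Fin 6 → F8 := m i • n + n i • m with hw
  have hwi : w i = 0 := by
    simp only [hw, Pi.add_apply, Pi.smul_apply, smul_eq_mul]
    rw [mul_comm]
    exact CharTwo.add_self_eq_zero _
  have hw0 (l) (hl : l ≠ i) : w l ≠ 0 := by
    simp only [hw, Pi.add_apply, Pi.smul_apply, smul_eq_mul]
    rw [Ne, CharTwo.add_eq_zero, mul_comm (n i)]
    exact hdet i l hl.symm
  let z : Fin 6 → F8 := fun l => m l * (w l)⁻¹
  have hz : Set.InjOn z (univ.erase i : Finset (Fin 6)) := by
    intro l hl k hk hlk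
    by_contra hne
    simp only [coe_erase, coe_univ, Set.mem_sdiff, Set.mem_univ, Set.mem_singleton_iff,
      true_and] at hl hk
    have : m l * w k = m k * w l := by
      simp only [z] at hlk
      field_simp [hw0 l hl, hw0 k hk] at hlk
      linear_combination hlk
    simp only [hw, Pi.add_apply, Pi.smul_apply, smul_eq_mul] at this
    exact hdet l k hne (mul_left_cancel₀ hi (by linear_combination this))
  obtain ⟨a, ha, hsum⟩ := exists_sum_erase_eq_zero ((univ.erase i).image z)
    (by rw [card_image_of_injOn hz]; simp)
  obtain ⟨j, hj, rfl⟩ := mem_image.mp ha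
  have hji : j ≠ i := ne_of_mem_erase hj
  set F : Finset (Fin 6) := (univ.erase i).erase j with hF
  have himage : ((univ.erase i).image z).erase (z j) = F.image z := by
    ext b
    simp only [hF, mem_erase, mem_image]
    constructor
    · rintro ⟨hb, l, hl, rfl⟩
      exact ⟨l, ⟨fun h => hb (h ▸ rfl), hl⟩, rfl⟩
    · rintro ⟨l, ⟨hlj, hl⟩, rfl⟩
      exact ⟨fun h => hlj (hz (by simpa using hl) (by simpa using hj) h), l, hl, rfl⟩
  rw [himage, sum_image (hz.mono (by rw [hF]; exact_mod_cast erase_subset _ _))] at hsum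
  let v : Fin 6 → F8 := fun l => if l ∈ F then (w l)⁻¹ else 0
  have hdot (f : Fin 6 → F8) : ∑ l, f l * v l = ∑ l ∈ F, f l * (w l)⁻¹ := by
    simp [v, mul_ite, sum_ite_mem]
  have hvm : ∑ l, m l * v l = 0 := by rw [hdot]; exact hsum
  have hFw (l) (hl : l ∈ F) : w l ≠ 0 := hw0 l (by simp [hF] at hl; exact hl.2)
  have hvw : ∑ l, w l * v l = 0 := by
    rw [hdot, sum_congr rfl fun l hl => mul_inv_cancel₀ (hFw l hl)]
    have : #F = 4 := by rw [hF, card_erase_of_mem hj]; simp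
    rw [sum_const, this]
    decide +kernel
  have hvn : ∑ l, n l * v l = 0 := by
    have h : m i * ∑ l, n l * v l + n i * ∑ l, m l * v l = ∑ l, w l * v l := by
      simp only [hw, mul_sum, ← sum_add_distrib, Pi.add_apply, Pi.smul_apply, smul_eq_mul]
      exact sum_congr rfl fun l _ => by ring
    rw [hvw, hvm, mul_zero, add_zero] at h
    exact (mul_eq_zero.mp h).resolve_left hi
  refine ⟨w, M₁.add_mem (M₁.smul_mem _ hn) (M₁.smul_mem _ hm), v, hM₂ v hvm hvn, ?_⟩
  have hcount : ∀ i j : Fin 6, j ≠ i →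
      ∑ l, (if l = i then 0 else if l = j then 3 else 1) = 7 := by decide
  refine (sum_le_sum fun l _ => ?_).trans (hcount i j hji).le
  split_ifs with hli hlj
  · subst hli
    simp [hwi, v, hF, cycleWt_zero_left]
  · subst hlj
    simp [v, hF, cycleWt_comm _ 0, cycleWt_zero_left, hw0 l hli]
  · have hl : l ∈ F := by simp [hF, hli, hlj]
    simp [v, hl, cycleWt_inv _ (hFw l hl)]

theorem hasOddPair_of_card_eq_two {S : Finset (Fin 6)} {B : Fin 6 → Fin 6 → F8}
    (h : SystematicPair M₁ M₂ S B) (hS : #S = 2) (hlow : ¬ HasLowPair M₁ M₂) (i : Fin 6) :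
    HasOddPair M₁ M₂ i := by
  obtain ⟨a, b, hab, rfl⟩ := card_eq_two.mp hS
  have hma := h.row_mem (s := a) (by simp)
  have hmb := h.row_mem (s := b) (by simp)
  have hM₂ := fun v => h.mem_right_of_orthogonal (v := v)
  simp only [forall_mem_insert, mem_singleton, forall_eq] at hM₂
  set m : Fin 6 → F8 := fun j => if j ∈ ({a, b} : Finset _) then if j = a then 1 else 0 else B a j
  set n : Fin 6 → F8 := fun j => if j ∈ ({a, b} : Finset _) then if j = b then 1 else 0 else B b j
  have hM (v) (h1 : ∑ j, m j * v j = 0) (h2 : ∑ j, n j * v j = 0) : v ∈ M₂ := hM₂ v ⟨h1, h2⟩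
  have hdet (j k) (hjk : j ≠ k) : m j * n k ≠ m k * n j := fun h =>
    hlow (hasLowPair_of_det_eq_zero hM hjk h)
  by_cases hi : m i = 0
  · refine hasOddPair_of_det_ne_zero hmb hma (fun v h1 h2 => hM v h2 h1)
      (fun j k hjk h => hdet k j hjk.symm (by linear_combination h)) (fun hni => ?_)
    obtain ⟨k, hk⟩ := exists_ne i
    exact hdet k i hk (by rw [hni, hi, mul_zero, zero_mul])
  · exact hasOddPair_of_det_ne_zero hma hmb hM hdet hi

theorem hasLowPair_or_hasOddPair (hdual : ∀ v, (∀ u ∈ M₁, ∑ j, u j * v j = 0) → v ∈ M₂) :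
    HasLowPair M₁ M₂ ∨ ∀ i, HasOddPair M₁ M₂ i := by
  obtain ⟨S, B, h⟩ := exists_systematicPair hdual
  have hcompl : #Sᶜ = 6 - #S := by rw [card_compl, Fintype.card_fin]
  by_cases hlow : HasLowPair M₁ M₂
  · exact .inl hlow
  have hlow' : ¬ HasLowPair M₂ M₁ := fun h => hlow h.symm
  obtain h1 | h2 | h3 | h4 | h5 : #S ≤ 1 ∨ #S = 2 ∨ #S = 3 ∨ #S = 4 ∨ 5 ≤ #S := by omega
  · exact .inl (hasLowPair_of_card_le_one h h1)
  · exact .inr (hasOddPair_of_card_eq_two h h2 hlow)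
  · exact .inl (hasLowPair_of_card_eq_three h h3)
  · exact .inr fun i => (hasOddPair_of_card_eq_two h.symm (by omega) hlow' i).symm
  · exact .inl (hasLowPair_of_card_le_one h.symm (by omega)).symm

end F8

theorem wt_eq_sum_cycles {p c f : ℕ} (v : Idx p c f → ZMod 2) :
    wt v = ∑ j, wt (fun k => v (.inl (j, k))) + wt fun l => v (.inr l) := by
  simp only [wt, card_filter, Fintype.sum_sum_type, Fintype.sum_prod_type]

theorem stdPerm_pow_inl : ∀ (n : Fin 7) (j : Fin 6) (k : Fin 7),
    (stdPerm 7 6 6 ^ (n : ℕ)) (.inl (j, k)) = .inl (j, k + n) := by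
  decide +kernel

theorem stdPerm_pow_inr : ∀ (n : Fin 7) (l : Fin 6),
    (stdPerm 7 6 6 ^ (n : ℕ)) (.inr l) = .inr l := by
  decide +kernel

theorem comp_pow_mem {ι : Type*} {σ : Equiv.Perm ι} {C : Submodule (ZMod 2) (ι → ZMod 2)}
    (haut : ∀ v, v ∈ C ↔ v ∘ σ ∈ C) {c : ι → ZMod 2} (hc : c ∈ C) (n : ℕ) :
    c ∘ (σ ^ n : Equiv.Perm ι) ∈ C := by
  induction n with
  | zero => exact hc
  | succ n ih =>
    rw [pow_succ]
    exact (haut _).mp ih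

/-- The word with blocks `traceWord β (u j)` on the cycles and zeros on the fixed points. -/
def traceVec (β : F8) (u : Fin 6 → F8) : Idx 7 6 6 → ZMod 2 :=
  Sum.elim (fun q => F8.traceWord β (u q.1) q.2) 0

theorem traceVec_add (β : F8) (u v : Fin 6 → F8) :
    traceVec β (u + v) = traceVec β u + traceVec β v := by
  funext i
  rcases i with q | l
  · simp [traceVec, F8.traceWord, add_mul]
  · simp [traceVec]

theorem traceVec_zero (β : F8) : traceVec β 0 = 0 := by
  funext i
  rcases i with q | l <;> simp [traceVec, F8.traceWord]

theorem traceVec_smul {β : F8}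
    (hrot : ∀ u k, F8.traceWord β (β * u) k = F8.traceWord β u (finRotate 7 k)) (u : Fin 6 → F8) :
    traceVec β (β • u) = traceVec β u ∘ stdPerm 7 6 6 := by
  funext i
  rcases i with q | l
  · exact hrot _ _
  · rfl

/-- The vectors `u` whose `traceVec` lies in the code. -/
def traceCode (C : Submodule (ZMod 2) (Idx 7 6 6 → ZMod 2))
    (haut : ∀ v, v ∈ C ↔ v ∘ stdPerm 7 6 6 ∈ C) (β : F8)
    (hrot : ∀ u k, F8.traceWord β (β * u) k = F8.traceWord β u (finRotate 7 k))
    (hgen : ∀ r : F8, r ≠ 0 → ∃ n : Fin 7, r = β ^ (n : ℕ)) : Submodule F8 (Fin 6 → F8) where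
  carrier := {u | traceVec β u ∈ C}
  add_mem' := fun {u v} hu hv => by
    rw [Set.mem_ofPred_eq, traceVec_add]
    exact C.add_mem hu hv
  zero_mem' := by
    rw [Set.mem_ofPred_eq, traceVec_zero]
    exact C.zero_mem
  smul_mem' := fun r u hu => by
    rw [Set.mem_ofPred_eq] at hu ⊢
    by_cases hr : r = 0
    · rw [hr, zero_smul, traceVec_zero]
      exact C.zero_mem
    obtain ⟨n, rfl⟩ := hgen r hr
    induction (n : ℕ) with
    | zero => rwa [pow_zero, one_smul]
    | succ n ih =>
      rw [pow_succ', mul_smul, traceVec_smul hrot]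
      exact (haut _).mp ih

/-- The word that is constantly `w j` on the `j`-th cycle and equals `e` on the fixed points. -/
def blockWord (w e : Fin 6 → ZMod 2) : Idx 7 6 6 → ZMod 2 := Sum.elim (fun q => w q.1) e

section Code

variable {C : Submodule (ZMod 2) (Idx 7 6 6 → ZMod 2)}

theorem traceVec_evalGen_mem (haut : ∀ v, v ∈ C ↔ v ∘ stdPerm 7 6 6 ∈ C)
    {c : Idx 7 6 6 → ZMod 2} (hc : c ∈ C) :
    traceVec F8.gen⁻¹ (fun j => F8.evalGen fun k => c (.inl (j, k))) ∈ C := by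
  convert C.add_mem (C.add_mem (C.add_mem hc (comp_pow_mem haut hc (3 : Fin 7)))
    (comp_pow_mem haut hc (5 : Fin 7))) (comp_pow_mem haut hc (6 : Fin 7)) using 1
  funext i
  rcases i with ⟨j, k⟩ | l
  · simp only [traceVec, Sum.elim_inl, F8.traceWord_evalGen, Pi.add_apply, Function.comp_apply,
      stdPerm_pow_inl]
  · simp only [traceVec, Sum.elim_inr, Pi.add_apply, Pi.zero_apply, Function.comp_apply,
      stdPerm_pow_inr]
    have h : ∀ x : ZMod 2, 0 = x + x + x + x := by decide
    exact h _

theorem traceVec_gen_mem (hself : C = dualCode C) (haut : ∀ v, v ∈ C ↔ v ∘ stdPerm 7 6 6 ∈ C)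
    {v : Fin 6 → F8} (hv : ∀ u, traceVec F8.gen⁻¹ u ∈ C → ∑ j, u j * v j = 0) :
    traceVec F8.gen v ∈ C := by
  rw [hself]
  intro c hc
  have h := congrArg F8.trace (hv _ (traceVec_evalGen_mem haut hc))
  rw [map_sum, map_zero] at h
  rw [← h, Fintype.sum_sum_type, Fintype.sum_prod_type]
  simp [traceVec, F8.traceWord_dot]

theorem dot_eq_zero (hself : C = dualCode C) {c d : Idx 7 6 6 → ZMod 2} (hc : c ∈ C)
    (hd : d ∈ C) : ∑ i, c i * d i = 0 := by
  rw [hself] at hc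
  exact hc d hd

theorem exists_eq_on_fixed (hself : C = dualCode C) (hmin : ∀ v ∈ C, v ≠ 0 → 10 ≤ wt v)
    (e : Fin 6 → ZMod 2) : ∃ c ∈ C, ∀ l, c (.inr l) = e l := by
  have htop : C.map (LinearMap.funLeft (ZMod 2) (ZMod 2) Sum.inr) = ⊤ := by
    by_contra hne
    obtain ⟨f, hf0, hf⟩ := Submodule.exists_le_ker_of_lt_top _ (lt_top_iff_ne_top.mpr hne)
    let y : Fin 6 → ZMod 2 := fun l => f (Pi.single l 1)
    have hfy (x : Fin 6 → ZMod 2) : f x = ∑ l, y l * x l := by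
      conv_lhs => rw [pi_eq_sum_univ' x, map_sum]
      exact sum_congr rfl fun l _ => by rw [map_smul, smul_eq_mul, mul_comm]
    have hmem : blockWord 0 y ∈ C := by
      rw [hself]
      intro c hc
      have h0 : f (LinearMap.funLeft (ZMod 2) (ZMod 2) Sum.inr c) = 0 :=
        hf (Submodule.mem_map_of_mem hc)
      rw [hfy] at h0
      simpa [blockWord, Fintype.sum_sum_type] using h0
    have hy : blockWord 0 y ≠ 0 := fun h => hf0 <| LinearMap.ext fun x => by
      have hyl (l) : y l = 0 := congrFun h (.inr l)
      simp [hfy, hyl]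
    have h10 := hmin _ hmem hy
    have h6 : wt y ≤ 6 := (card_filter_le _ _).trans (by simp)
    rw [wt_eq_sum_cycles] at h10
    simp only [blockWord, Sum.elim_inl, Sum.elim_inr, Pi.zero_apply] at h10
    simp [wt] at h10 h6
    omega
  obtain ⟨c, hc, hce⟩ := (htop ▸ Submodule.mem_top : e ∈ C.map _)
  exact ⟨c, hc, fun l => congrFun hce l⟩

theorem exists_blockWord_mem (hself : C = dualCode C) (hmin : ∀ v ∈ C, v ≠ 0 → 10 ≤ wt v)
    (haut : ∀ v, v ∈ C ↔ v ∘ stdPerm 7 6 6 ∈ C) (e : Fin 6 → ZMod 2) :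
    ∃ w, blockWord w e ∈ C := by
  obtain ⟨c, hc, hce⟩ := exists_eq_on_fixed hself hmin e
  refine ⟨fun j => ∑ k, c (.inl (j, k)), ?_⟩
  convert C.sum_mem (t := univ) fun (n : Fin 7) _ => comp_pow_mem haut hc n using 1
  funext i
  rw [Finset.sum_apply]
  rcases i with ⟨j, k⟩ | l
  · simp only [blockWord, Sum.elim_inl, Function.comp_apply, stdPerm_pow_inl]
    exact (Equiv.sum_comp (Equiv.addLeft k) fun k => c (.inl (j, k))).symm
  · simp only [blockWord, Sum.elim_inr, Function.comp_apply, stdPerm_pow_inr, hce]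
    generalize e l = x
    revert x
    decide

theorem dot_blockWord (w e w' e' : Fin 6 → ZMod 2) :
    ∑ i, blockWord w e i * blockWord w' e' i = ∑ j, w j * w' j + ∑ l, e l * e' l := by
  rw [Fintype.sum_sum_type, Fintype.sum_prod_type]
  simp only [blockWord, Sum.elim_inl, Sum.elim_inr, sum_const, card_univ, Fintype.card_fin,
    nsmul_eq_mul]
  have h7 : ((7 : ℕ) : ZMod 2) = 1 := by decide
  simp only [h7, one_mul]

theorem wt_blockWord (w e : Fin 6 → ZMod 2) : wt (blockWord w e) = 7 * wt w + wt e := by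
  rw [wt_eq_sum_cycles]
  congr 1
  simp only [blockWord, Sum.elim_inl]
  simp only [wt, card_filter, mul_sum]
  refine sum_congr rfl fun j _ => ?_
  simp

theorem wt_single : ∀ l : Fin 6, wt (Pi.single l 1 : Fin 6 → ZMod 2) = 1 := by decide

/-- Some codeword is constantly one on all cycles but one, and has a single fixed coordinate. -/
theorem exists_blockWord_five_mem (hself : C = dualCode C)
    (hmin : ∀ v ∈ C, v ≠ 0 → 10 ≤ wt v) (haut : ∀ v, v ∈ C ↔ v ∘ stdPerm 7 6 6 ∈ C) :
    ∃ i l, blockWord (fun j => if j = i then 0 else 1) (Pi.single l 1) ∈ C := by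
  choose w hw using fun l : Fin 6 => exists_blockWord_mem hself hmin haut (Pi.single l 1)
  have horth (l m) : ∑ j, w l j * w m j = if l = m then 1 else 0 := by
    have h := dot_eq_zero hself (hw l) (hw m)
    rw [dot_blockWord, CharTwo.add_eq_zero] at h
    simpa [Pi.single_apply, eq_comm (a := m)] using h
  have hwt (l) : 2 ≤ wt (w l) := by
    have h := hmin _ (hw l) fun h0 => by simpa [blockWord] using congrFun h0 (.inr l)
    rw [wt_blockWord, wt_single] at h
    omega
  obtain ⟨l, hl⟩ := exists_wt_five_of_orthonormal w horth hwt
  obtain ⟨i, hi⟩ := exists_eq_one_sub_single_of_wt_five _ hl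
  exact ⟨i, l, hi ▸ hw l⟩

theorem not_hasLowPair (hmin : ∀ v ∈ C, v ≠ 0 → 10 ≤ wt v) {M₁ M₂ : Submodule F8 (Fin 6 → F8)}
    (h₁ : ∀ u ∈ M₁, traceVec F8.gen⁻¹ u ∈ C) (h₂ : ∀ v ∈ M₂, traceVec F8.gen v ∈ C) :
    ¬ F8.HasLowPair M₁ M₂ := by
  rintro ⟨u, hu, v, hv, hpos, hle⟩
  have hwt : wt (traceVec F8.gen⁻¹ u + traceVec F8.gen v) = ∑ j, F8.cycleWt (u j) (v j) := by
    rw [wt_eq_sum_cycles]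
    simp only [traceVec, Pi.add_apply, Sum.elim_inl, Sum.elim_inr, F8.cycleWt_eq_wt]
    simp [wt]
  have h10 := hmin _ (C.add_mem (h₁ u hu) (h₂ v hv)) fun h0 => by
    rw [h0] at hwt
    simp [wt] at hwt
    omega
  omega

theorem not_hasOddPair (hmin : ∀ v ∈ C, v ≠ 0 → 10 ≤ wt v) {M₁ M₂ : Submodule F8 (Fin 6 → F8)}
    (h₁ : ∀ u ∈ M₁, traceVec F8.gen⁻¹ u ∈ C) (h₂ : ∀ v ∈ M₂, traceVec F8.gen v ∈ C) {i l : Fin 6}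
    (hb : blockWord (fun j => if j = i then 0 else 1) (Pi.single l 1) ∈ C) :
    ¬ F8.HasOddPair M₁ M₂ i := by
  rintro ⟨u, hu, v, hv, hle⟩
  have h10 := hmin _ (C.add_mem hb (C.add_mem (h₁ u hu) (h₂ v hv))) fun h0 => by
    simpa [blockWord, traceVec] using congrFun h0 (.inr l)
  rw [wt_eq_sum_cycles] at h10
  have hfix : wt (fun m => (blockWord (fun j => if j = i then 0 else 1) (Pi.single l 1) +
      (traceVec F8.gen⁻¹ u + traceVec F8.gen v)) (.inr m)) = 1 := by
    rw [← wt_single l]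
    congr 1
    funext m
    simp [blockWord, traceVec]
  have hcyc (j : Fin 6) : wt (fun k => (blockWord (fun j => if j = i then 0 else 1)
      (Pi.single l 1) + (traceVec F8.gen⁻¹ u + traceVec F8.gen v)) (.inl (j, k))) =
      if j = i then F8.cycleWt (u j) (v j) else 7 - F8.cycleWt (u j) (v j) := by
    simp only [blockWord, traceVec, Pi.add_apply, Sum.elim_inl]
    split_ifs with hj
    · simp only [zero_add, F8.cycleWt_eq_wt]
    · exact F8.wt_one_add_traceWord _ _
  rw [hfix, sum_congr rfl fun j _ => hcyc j] at h10
  omega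

/-- No binary self-dual code of length `48` and minimum weight at least `10` has an automorphism of
type `7-(6,6)`. -/
theorem not_selfDual_of_stdPerm (hself : C = dualCode C) (hmin : ∀ v ∈ C, v ≠ 0 → 10 ≤ wt v)
    (haut : ∀ v, v ∈ C ↔ v ∘ stdPerm 7 6 6 ∈ C) : False := by
  let M₁ := traceCode C haut F8.gen⁻¹ F8.traceWord_gen_inv_mul F8.exists_gen_inv_pow
  let M₂ := traceCode C haut F8.gen F8.traceWord_gen_mul F8.exists_gen_pow
  have h₁ : ∀ u ∈ M₁, traceVec F8.gen⁻¹ u ∈ C := fun _ h => h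
  have h₂ : ∀ v ∈ M₂, traceVec F8.gen v ∈ C := fun _ h => h
  obtain ⟨i, l, hb⟩ := exists_blockWord_five_mem hself hmin haut
  have hdual : ∀ v, (∀ u ∈ M₁, ∑ j, u j * v j = 0) → v ∈ M₂ := fun v hv =>
    traceVec_gen_mem hself haut hv
  rcases F8.hasLowPair_or_hasOddPair hdual with hlow | hodd
  · exact not_hasLowPair hmin h₁ h₂ hlow
  · exact not_hasOddPair hmin h₁ h₂ hb (hodd i)

end Code

/-- For a binary self-dual [48,24,10] code with an automorphism of order 7 of type
7-(6,6) (standard form), the projection `π(F_σ(C))` is a self-dual [12,6] code whose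
nonzero words `(w₁,w₂)` satisfy `7·wt(w₁) + wt(w₂) ≥ 10`, and it has a generator
matrix `(I₆ | A)` with `A` as stated, up to a permutation of the columns of `A`. -/
theorem statement19
    (C : Submodule (ZMod 2) (Idx 7 6 6 → ZMod 2))
    (hself : C = dualCode C)
    (hdim : Module.finrank (ZMod 2) C = 24)
    (hmin : ∀ v ∈ C, v ≠ 0 → 10 ≤ wt v) (hex : ∃ v ∈ C, wt v = 10)
    (haut : ∀ v, v ∈ C ↔ v ∘ (stdPerm 7 6 6) ∈ C) :
    Submodule.map (proj 7 6 6) (fixedCode (stdPerm 7 6 6) C) =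
      dualCode (Submodule.map (proj 7 6 6) (fixedCode (stdPerm 7 6 6) C)) ∧
    Module.finrank (ZMod 2)
      (Submodule.map (proj 7 6 6) (fixedCode (stdPerm 7 6 6) C)) = 6 ∧
    (∀ w ∈ Submodule.map (proj 7 6 6) (fixedCode (stdPerm 7 6 6) C), w ≠ 0 →
      10 ≤ 7 * wt (fun j : Fin 6 => w (Sum.inl j)) + wt (fun l : Fin 6 => w (Sum.inr l))) ∧
    (∃ τ : Equiv.Perm (Fin 6),
      Submodule.map (proj 7 6 6) (fixedCode (stdPerm 7 6 6) C) =
        Submodule.span (ZMod 2)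
          {w : Fin 6 ⊕ Fin 6 → ZMod 2 | ∃ i : Fin 6,
            w = Sum.elim (fun j => if j = i then 1 else 0)
                         (fun l => matA i (τ l))}) := by
  exact (not_selfDual_of_stdPerm hself hmin haut).elim
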